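/- For ideals I ⊂ k[x₀,x₁,y₀,y₁] generated by r bihomogeneous forms of prescribed bidegrees, there exists a nonempty Zariski open subset of the parameter space 𝔸^N of coefficient tuples on which the bigraded Hilbert series of S/I is constant, and this constant series is the coefficientwise smallest Hilbert series among all such ideals. -/

import Mathlib

open MvPolynomial

/-- The bigrading on `S = k[x₀,x₁,y₀,y₁]`: `deg x₀ = deg x₁ = (1,0)`,
`deg y₀ = deg y₁ = (0,1)`. -/
noncomputable def bidegWt : Fin 4 → ℕ × ℕ := ![(1,0), (1,0), (0,1), (0,1)]

/-- The bigraded Hilbert function of `S/I`. -/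
noncomputable def hilb (k : Type*) [Field k] (I : Ideal (MvPolynomial (Fin 4) k))
    (p : ℕ × ℕ) : ℕ :=
  Module.finrank k
    ((weightedHomogeneousSubmodule k bidegWt p).map (Ideal.Quotient.mkₐ k I).toLinearMap)

/-- Index set for the coefficients of `r` bihomogeneous forms of bidegrees `(dᵢ,eᵢ)`:
the parameter space `𝔸^N`, `N = Σ (dᵢ+1)(eᵢ+1)`, is `coeffIdx r d e → k`. -/
def coeffIdx (r : ℕ) (d e : Fin r → ℕ) : Type :=
  (i : Fin r) × (Fin (d i + 1) × Fin (e i + 1))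

/-- The `i`-th bihomogeneous form of bidegree `(dᵢ,eᵢ)` with coefficient tuple `c`:
`∑_{a,b} c(i,a,b) · x₀^a x₁^{dᵢ−a} y₀^b y₁^{eᵢ−b}`. -/
noncomputable def formOf {k : Type*} [Field k] {r : ℕ} {d e : Fin r → ℕ}
    (c : coeffIdx r d e → k) (i : Fin r) : MvPolynomial (Fin 4) k :=
  ∑ a : Fin (d i + 1), ∑ b : Fin (e i + 1),
    MvPolynomial.C (c ⟨i, (a, b)⟩) *
      X 0 ^ (a : ℕ) * X 1 ^ (d i - a) * X 2 ^ (b : ℕ) * X 3 ^ (e i - b)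

/-- A subset of affine space `ι → k` is Zariski open iff it is a union of complements
of hypersurfaces, i.e. the set of points where some polynomial in a set `T` is nonzero. -/
def IsZariskiOpen {k : Type*} [Field k] {ι : Type} (U : Set (ι → k)) : Prop :=
  ∃ T : Set (MvPolynomial ι k), U = { c | ∃ f ∈ T, MvPolynomial.eval c f ≠ 0 }

namespace MonomialOrder

variable {σ : Type*} (m : MonomialOrder σ)

theorem linearIndependent_of_injective_degree {R ι : Type*} [CommRing R] [IsDomain R]
    {g : ι → MvPolynomial σ R} (hg : ∀ i, g i ≠ 0)
    (hinj : Function.Injective fun i => m.degree (g i)) : LinearIndependent R g := by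
  classical
  rw [linearIndependent_iff']
  intro s a hsum i hi
  by_contra hai
  obtain ⟨j, hj, hmax⟩ := (s.filter (a · ≠ 0)).exists_max_image
    (fun i => m.toSyn (m.degree (g i))) ⟨i, by simp [hi, hai]⟩
  rw [Finset.mem_filter] at hj
  have h := congrArg (coeff (m.degree (g j))) hsum
  rw [coeff_sum, Finset.sum_eq_single j] at h
  · simp only [coeff_smul, smul_eq_mul, coeff_zero, mul_eq_zero] at h
    exact h.elim hj.2 (m.coeff_degree_ne_zero_iff.mpr (hg j))
  · intro l hl hlj
    by_cases hal : a l = 0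
    · simp [hal]
    · rw [coeff_smul, m.coeff_eq_zero_of_lt, smul_zero]
      exact lt_of_le_of_ne (hmax l (by simp [hl, hal]))
        fun h => hlj (hinj (m.toSyn.injective h))
  · exact fun h => absurd hj.1 h

/-- The exponents of leading monomials of nonzero `w`-homogeneous elements of `I`. -/
def homogeneousDegrees {R M : Type*} [CommRing R] [AddCommMonoid M] (w : σ → M)
    (I : Ideal (MvPolynomial σ R)) : Set (σ →₀ ℕ) :=
  {d | ∃ g ∈ I, IsWeightedHomogeneous w g (Finsupp.weight w d) ∧ g ≠ 0 ∧ m.degree g = d}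

theorem monomial_mul_ne_zero_and_degree_eq {R : Type*} [CommRing R] [IsDomain R]
    {g : MvPolynomial σ R}
    (hg : g ≠ 0) (e : σ →₀ ℕ) :
    monomial e 1 * g ≠ 0 ∧ m.degree (monomial e 1 * g) = e + m.degree g := by
  classical
  have he : (monomial e (1 : R)) ≠ 0 := by simp
  exact ⟨mul_ne_zero he hg, by rw [m.degree_mul he hg, m.degree_monomial]; simp⟩

/-- A single nonzero scalar `f` such that homogeneous elements realising every leading monomial of
`I` specialise to elements with the same leading monomial wherever `f` does not vanish. -/
theorem exists_ne_zero_homogeneousDegrees_subset_map {R M : Type*} [Finite σ] [CommRing R]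
    [IsDomain R] [AddCommMonoid M] (w : σ → M) (I : Ideal (MvPolynomial σ R)) :
    ∃ f : R, f ≠ 0 ∧ ∀ {K : Type _} [Field K] (φ : R →+* K), φ f ≠ 0 →
      m.homogeneousDegrees w I ⊆ m.homogeneousDegrees w (I.map (MvPolynomial.map φ)) := by
  classical
  set L := m.homogeneousDegrees w I
  have hfin : {d | Minimal (· ∈ L) d}.Finite :=
    WellQuasiOrderedLE.finite_of_isAntichain (setOfPred_minimal_antichain _)
  choose! g hgI hgw hg0 hgd using fun d (hd : d ∈ L) => hd
  refine ⟨∏ d ∈ hfin.toFinset, m.leadingCoeff (g d), ?_, ?_⟩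
  · refine Finset.prod_ne_zero_iff.mpr fun d hd => ?_
    rw [m.leadingCoeff_ne_zero_iff]
    exact hg0 d ((hfin.mem_toFinset.mp hd).prop)
  intro K _ φ hf d hd
  obtain ⟨b, hbd, hb⟩ := exists_minimal_le_of_wellFoundedLT (· ∈ L) d hd
  rw [map_prod, Finset.prod_ne_zero_iff] at hf
  have hlc := hf b (hfin.mem_toFinset.mpr hb)
  have hbL : b ∈ L := hb.prop
  have hcoeff : coeff b (MvPolynomial.map φ (g b)) ≠ 0 := by
    rw [coeff_map]
    convert hlc using 2
    rw [leadingCoeff, hgd b hbL]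
  have hne : MvPolynomial.map φ (g b) ≠ 0 := fun h => hcoeff (by rw [h, coeff_zero])
  have hdeg : m.degree (MvPolynomial.map φ (g b)) = b := by
    refine m.toSyn.injective (le_antisymm ?_ (m.le_degree (mem_support_iff.mpr hcoeff)))
    conv_rhs => rw [← hgd b hbL]
    exact m.degree_le_iff.mpr fun e he => m.le_degree (support_map_subset φ _ he)
  obtain ⟨hmul, hmuldeg⟩ := m.monomial_mul_ne_zero_and_degree_eq hne (d - b)
  refine ⟨_, Ideal.mul_mem_left _ _ (Ideal.mem_map_of_mem _ (hgI b hbL)), ?_, hmul, ?_⟩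
  · rw [← tsub_add_cancel_of_le hbd, map_add, tsub_add_cancel_of_le hbd]
    refine (isWeightedHomogeneous_monomial w (d - b) 1 rfl).mul ?_
    intro e he
    rw [coeff_map] at he
    exact hgw b hbL fun h => he (by rw [h, map_zero])
  · rw [hmuldeg, hdeg, tsub_add_cancel_of_le hbd]

end MonomialOrder

namespace MvPolynomial

variable {σ k : Type*} [Field k]

theorem finiteDimensional_weightedHomogeneousSubmodule {M : Type*} [AddCommMonoid M] {w : σ → M}
    {p : M} (hp : {d : σ →₀ ℕ | Finsupp.weight w d = p}.Finite) :
    FiniteDimensional k (weightedHomogeneousSubmodule k w p) := by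
  have : FiniteDimensional k
      (Submodule.span k ((fun d => monomial d (1 : k)) '' {d : σ →₀ ℕ | Finsupp.weight w d = p})) :=
    FiniteDimensional.span_of_finite k (hp.image _)
  refine Submodule.finiteDimensional_of_le (S₂ := Submodule.span k
    ((fun d => monomial d (1 : k)) '' {d | Finsupp.weight w d = p})) (fun f hf => ?_)
  rw [f.as_sum]
  refine Submodule.sum_mem _ fun d hd => ?_
  rw [← mul_one (coeff d f), ← smul_eq_mul, ← smul_monomial]
  exact Submodule.smul_mem _ _
    (Submodule.subset_span ⟨d, hf (mem_support_iff.mp hd), rfl⟩)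

theorem linearIndependent_of_map {A ι : Type*} [CommRing A] [IsDomain A] [Algebra k A]
    [Finite ι] (φ : A →+* k) (hφ : ∀ a, φ (algebraMap k A a) = a)
    {Q : ι → MvPolynomial σ A} (hQ : LinearIndependent k fun j => map φ (Q j)) :
    LinearIndependent A Q := by
  classical
  have := Fintype.ofFinite ι
  obtain ⟨B, hB⟩ := (Fintype.linearCombination k fun j => map φ (Q j)).exists_leftInverse_of_injective
    (LinearMap.ker_eq_bot.mpr (linearIndependent_iff_injective_fintypeLinearCombination.mp hQ))
  let BA : MvPolynomial σ A →ₗ[A] ι → A :=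
    (basisMonomials σ A).constr A fun d i => algebraMap k A (B (monomial d 1) i)
  have hBA : ∀ f i, φ (BA f i) = B (map φ f) i := by
    intro f i
    induction f using MvPolynomial.induction_on' with
    | monomial d a =>
      have h1 : BA (monomial d 1) = fun i => algebraMap k A (B (monomial d 1) i) := by
        have := (basisMonomials σ A).constr_basis A
          (fun d i => algebraMap k A (B (monomial d 1) i)) d
        rwa [coe_basisMonomials] at this
      have h2 : monomial d a = a • monomial d (1 : A) := by simp [smul_monomial]
      have h3 : monomial d (φ a) = φ a • monomial d (1 : k) := by simp [smul_monomial]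
      rw [map_monomial, h2, h3, map_smul, map_smul, h1]
      simp [hφ]
    | add f g hf hg => simp [hf, hg]
  let N : Matrix ι ι A := Matrix.of fun i j => BA (Q j) i
  have hN : φ.mapMatrix N = 1 := by
    ext i j
    have h := congrFun (LinearMap.congr_fun hB (Pi.single j 1)) i
    simp only [LinearMap.comp_apply, Fintype.linearCombination_apply_single, one_smul,
      LinearMap.id_apply] at h
    simp only [RingHom.mapMatrix_apply, Matrix.map_apply, N, Matrix.of_apply, hBA, h,
      Matrix.one_apply, Pi.single_apply]
  have hdet : N.det ≠ 0 := fun h => by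
    have := φ.map_det N
    rw [hN, h] at this
    simp at this
  rw [Fintype.linearIndependent_iff]
  intro a ha
  refine congrFun (Matrix.eq_zero_of_mulVec_eq_zero hdet ?_)
  ext i
  have := congrFun (congrArg BA ha) i
  simpa [N, Matrix.mulVec, dotProduct, mul_comm] using this

theorem finrank_inf_map_le_ncard {A M : Type*} [CommRing A] [IsDomain A] [Algebra k A]
    [AddCommMonoid M] (m : MonomialOrder σ) {w : σ → M} {p : M}
    (hp : {d : σ →₀ ℕ | Finsupp.weight w d = p}.Finite) (φ : A →+* k)
    (hφ : ∀ a, φ (algebraMap k A a) = a) {I : Ideal (MvPolynomial σ A)}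
    (hI : ∀ f ∈ I, weightedHomogeneousComponent w p f ∈ I) :
    Module.finrank k ↥(weightedHomogeneousSubmodule k w p ⊓
        (I.map (map φ)).restrictScalars k) ≤
      (m.homogeneousDegrees w I ∩ {d : σ →₀ ℕ | Finsupp.weight w d = p}).ncard := by
  classical
  set V := weightedHomogeneousSubmodule k w p ⊓ (I.map (map φ)).restrictScalars k
  set L := m.homogeneousDegrees w I ∩ {d : σ →₀ ℕ | Finsupp.weight w d = p}
  have := finiteDimensional_weightedHomogeneousSubmodule (k := k) hp
  have : FiniteDimensional k V := Submodule.finiteDimensional_of_le inf_le_left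
  have hsurj : Function.Surjective (map (σ := σ) φ) :=
    map_surjective φ fun a => ⟨_, hφ a⟩
  have hlift : ∀ v : V, ∃ q ∈ I, IsWeightedHomogeneous w q p ∧ map φ q = v := by
    rintro ⟨v, hv, hvI⟩
    obtain ⟨q, hq, rfl⟩ := (Ideal.mem_map_iff_of_surjective _ hsurj).mp hvI
    refine ⟨_, hI q hq, weightedHomogeneousComponent_isWeightedHomogeneous p q, ?_⟩
    ext d
    rw [coeff_map, coeff_weightedHomogeneousComponent]
    split_ifs with h
    · rw [coeff_map]
    · rw [map_zero]
      exact (IsWeightedHomogeneous.coeff_eq_zero hv d h).symm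
  choose q hqI hqw hqv using hlift
  let b := Module.finBasis k V
  have hind : LinearIndependent A fun j => q (b j) := by
    refine linearIndependent_of_map φ hφ ?_
    simp only [hqv]
    exact b.linearIndependent.map' V.subtype V.ker_subtype
  have hL : L.Finite := hp.inter_of_right _
  have := hL.fintype
  let T : (Fin (Module.finrank k V) → A) →ₗ[A] (L → A) :=
    LinearMap.pi (fun d => lcoeff A d.1) ∘ₗ Fintype.linearCombination A fun j => q (b j)
  have hT : Function.Injective T := by
    rw [← LinearMap.ker_eq_bot, LinearMap.ker_eq_bot']
    intro a ha
    refine linearIndependent_iff_injective_fintypeLinearCombination.mp hind ?_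
    rw [map_zero]
    by_contra hne
    set f := Fintype.linearCombination A (fun j => q (b j)) a with hf
    have hfI : f ∈ I := by
      rw [hf, Fintype.linearCombination_apply]
      exact sum_mem fun j _ => Submodule.smul_of_tower_mem I _ (hqI _)
    have hfw : f ∈ weightedHomogeneousSubmodule A w p := by
      rw [hf, Fintype.linearCombination_apply]
      exact sum_mem fun j _ => Submodule.smul_mem _ _ (hqw _)
    have hdeg : Finsupp.weight w (m.degree f) = p := hfw (m.coeff_degree_ne_zero_iff.mpr hne)
    have hmem : m.degree f ∈ L := ⟨⟨f, hfI, hdeg.symm ▸ hfw, hne, rfl⟩, hdeg⟩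
    exact m.coeff_degree_ne_zero_iff.mpr hne (congrFun ha ⟨_, hmem⟩)
  have := card_le_of_injective A T hT
  rwa [Fintype.card_fin, ← Nat.card_eq_fintype_card, Nat.card_coe_set_eq] at this

theorem ncard_le_finrank_inf {M : Type*} [AddCommMonoid M] (m : MonomialOrder σ) {w : σ → M}
    {p : M} (hp : {d : σ →₀ ℕ | Finsupp.weight w d = p}.Finite) (J : Ideal (MvPolynomial σ k)) :
    (m.homogeneousDegrees w J ∩ {d : σ →₀ ℕ | Finsupp.weight w d = p}).ncard ≤
      Module.finrank k ↥(weightedHomogeneousSubmodule k w p ⊓ J.restrictScalars k) := by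
  set V := weightedHomogeneousSubmodule k w p ⊓ J.restrictScalars k
  set L := m.homogeneousDegrees w J ∩ {d : σ →₀ ℕ | Finsupp.weight w d = p}
  have := finiteDimensional_weightedHomogeneousSubmodule (k := k) hp
  have : FiniteDimensional k V := Submodule.finiteDimensional_of_le inf_le_left
  have := (hp.inter_of_right (m.homogeneousDegrees w J)).fintype
  choose g hgJ hgw hg0 hgd using fun d : L => d.2.1
  have hind : LinearIndependent k g :=
    m.linearIndependent_of_injective_degree hg0 fun d e h => Subtype.ext (by
      simpa only [hgd] using h)
  have hV : LinearIndependent k fun d => (⟨g d, by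
      have := hgw d
      rw [d.2.2] at this
      exact ⟨this, hgJ d⟩⟩ : V) :=
    LinearIndependent.of_comp V.subtype hind
  have := hV.fintype_card_le_finrank
  rwa [← Nat.card_eq_fintype_card, Nat.card_coe_set_eq] at this

end MvPolynomial

theorem finite_setOf_weight_bidegWt_eq (p : ℕ × ℕ) :
    {d : Fin 4 →₀ ℕ | Finsupp.weight bidegWt d = p}.Finite := by
  refine (Set.finite_Icc 0 (Finsupp.equivFunOnFinite.symm fun _ => p.1 + p.2)).subset ?_
  rintro d rfl
  refine ⟨zero_le, fun i => ?_⟩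
  simp only [Finsupp.weight_apply, Finsupp.sum_fintype, zero_smul, implies_true,
    Fin.sum_univ_four, bidegWt]
  fin_cases i <;> simp <;> omega

theorem hilb_add_finrank_inf (k : Type*) [Field k] (I : Ideal (MvPolynomial (Fin 4) k))
    (p : ℕ × ℕ) :
    hilb k I p + Module.finrank k
        ↥(weightedHomogeneousSubmodule k bidegWt p ⊓ I.restrictScalars k) =
      Module.finrank k (weightedHomogeneousSubmodule k bidegWt p) := by
  have := finiteDimensional_weightedHomogeneousSubmodule (k := k)
    (finite_setOf_weight_bidegWt_eq p)
  set S := weightedHomogeneousSubmodule k bidegWt p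
  rw [← ((Ideal.Quotient.mkₐ k I).toLinearMap.domRestrict S).finrank_range_add_finrank_ker,
    LinearMap.range_domRestrict, LinearMap.ker_domRestrict, hilb]
  congr 1
  have hker : LinearMap.ker (Ideal.Quotient.mkₐ k I).toLinearMap = I.restrictScalars k := by
    ext f
    simp [Ideal.Quotient.eq_zero_iff_mem]
  rw [hker, ← Submodule.map_comap_subtype, Submodule.finrank_map_subtype_eq]

/-- The `i`-th form with indeterminate coefficients. -/
noncomputable def genericForm (k : Type*) [Field k] {r : ℕ} (d e : Fin r → ℕ) (i : Fin r) :
    MvPolynomial (Fin 4) (MvPolynomial (coeffIdx r d e) k) :=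
  ∑ a : Fin (d i + 1), ∑ b : Fin (e i + 1),
    C (X ⟨i, (a, b)⟩) * X 0 ^ (a : ℕ) * X 1 ^ (d i - a) * X 2 ^ (b : ℕ) * X 3 ^ (e i - b)

section

variable {k : Type*} [Field k] {r : ℕ} {d e : Fin r → ℕ}

theorem map_eval_genericForm (c : coeffIdx r d e → k) (i : Fin r) :
    MvPolynomial.map (eval c) (genericForm k d e i) = formOf c i := by
  have hX (a b) : eval c (X ⟨i, (a, b)⟩) = c ⟨i, (a, b)⟩ := eval_X _
  simp [genericForm, formOf, hX]

theorem isWeightedHomogeneous_genericForm (i : Fin r) :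
    IsWeightedHomogeneous bidegWt (genericForm k d e i) (d i, e i) := by
  refine IsWeightedHomogeneous.sum _ _ _ fun a _ => IsWeightedHomogeneous.sum _ _ _ fun b _ => ?_
  have hX (j : Fin 4) (n : ℕ) := (isWeightedHomogeneous_X
    (MvPolynomial (coeffIdx r d e) k) bidegWt j).pow n
  convert (((((isWeightedHomogeneous_C bidegWt (X ⟨i, (a, b)⟩ :
    MvPolynomial (coeffIdx r d e) k)).mul (hX 0 a)).mul (hX 1 (d i - a))).mul
    (hX 2 b)).mul (hX 3 (e i - b))) using 1
  simp [bidegWt]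
  omega

theorem weightedHomogeneousComponent_mem_span_genericForm (p : ℕ × ℕ) :
    ∀ f ∈ Ideal.span (Set.range (genericForm k d e)),
      weightedHomogeneousComponent bidegWt p f ∈ Ideal.span (Set.range (genericForm k d e)) := by
  let _ := weightedGradedAlgebra (MvPolynomial (coeffIdx r d e) k) bidegWt
  refine fun f hf => weightedHomogeneousComponent_mem_of_mem _ _ ?_ hf p
  refine Ideal.homogeneous_span _ _ ?_
  rintro _ ⟨i, rfl⟩
  exact ⟨_, isWeightedHomogeneous_genericForm i⟩

theorem map_eval_span_genericForm (c : coeffIdx r d e → k) :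
    (Ideal.span (Set.range (genericForm k d e))).map (MvPolynomial.map (eval c)) =
      Ideal.span (Set.range (formOf c)) := by
  rw [Ideal.map_span, ← Set.range_comp]
  congr 2
  exact funext (map_eval_genericForm c)

end

/-- There is a nonempty Zariski open subset of the parameter space `𝔸^N` of
coefficient tuples of `r` bihomogeneous forms of prescribed bidegrees on which the
bigraded Hilbert series of `S/I` is constant, and this constant series is
coefficientwise smallest among all ideals generated by forms of those bidegrees. -/
theorem generic_hilbert_series_exists (k : Type*) [Field k] [Infinite k]
    (r : ℕ) (d e : Fin r → ℕ) :
    ∃ U : Set (coeffIdx r d e → k), IsZariskiOpen U ∧ U.Nonempty ∧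
      ∃ h : ℕ × ℕ → ℕ,
        (∀ c ∈ U, hilb k (Ideal.span (Set.range (formOf c))) = h) ∧
        (∀ c : coeffIdx r d e → k, ∀ p : ℕ × ℕ,
          h p ≤ hilb k (Ideal.span (Set.range (formOf c))) p) := by
  let m : MonomialOrder (Fin 4) := MonomialOrder.lex
  let I := Ideal.span (Set.range (genericForm k d e))
  let L (p : ℕ × ℕ) := m.homogeneousDegrees bidegWt I ∩ {a | Finsupp.weight bidegWt a = p}
  obtain ⟨f, hf, hspec⟩ := m.exists_ne_zero_homogeneousDegrees_subset_map bidegWt I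
  have hupper (c : coeffIdx r d e → k) (p : ℕ × ℕ) :
      Module.finrank k ↥(weightedHomogeneousSubmodule k bidegWt p ⊓
        (Ideal.span (Set.range (formOf c))).restrictScalars k) ≤ (L p).ncard := by
    rw [← map_eval_span_genericForm]
    exact finrank_inf_map_le_ncard m (finite_setOf_weight_bidegWt_eq p) (eval c)
      (fun a => eval_C a) (weightedHomogeneousComponent_mem_span_genericForm p)
  refine ⟨{c | eval c f ≠ 0}, ⟨{f}, by simp⟩, ?_,
    fun p => Module.finrank k (weightedHomogeneousSubmodule k bidegWt p) - (L p).ncard, ?_, ?_⟩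
  · by_contra hempty
    refine hf (MvPolynomial.funext fun c => ?_)
    rw [map_zero]
    by_contra hc
    exact hempty ⟨c, hc⟩
  · intro c hc
    funext p
    have hlower : (L p).ncard ≤ Module.finrank k ↥(weightedHomogeneousSubmodule k bidegWt p ⊓
        (Ideal.span (Set.range (formOf c))).restrictScalars k) := by
      refine le_trans ?_ (ncard_le_finrank_inf m (finite_setOf_weight_bidegWt_eq p) _)
      rw [← map_eval_span_genericForm]
      exact Set.ncard_le_ncard (Set.inter_subset_inter_left _ (hspec (eval c) hc))
        ((finite_setOf_weight_bidegWt_eq p).inter_of_right _)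
    have := hilb_add_finrank_inf k (Ideal.span (Set.range (formOf c))) p
    have := hupper c p
    omega
  · intro c p
    have := hilb_add_finrank_inf k (Ideal.span (Set.range (formOf c))) p
    have := hupper c p
    dsimp only
    omega
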